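/- Let G be a group generated by a finite nonempty set S, let φ be an automorphism of G, let g ∈ G, and let ψ be the automorphism of G defined by ψ(x) = g·φ(x)·g⁻¹. Suppose there exist a constant C > 0 and p ∈ ℕ such that max over s ∈ S of |φⁿ(s)|_S is at most C·(n+1)ᵖ for all n ∈ ℕ. Then there exists a constant C' > 0 such that max over s ∈ S of |ψⁿ(s)|_S is at most C'·(n+1)^(p+1) for all n ∈ ℕ. -/

import Mathlib

/-- The word length of `g ∈ G` with respect to a generating set `S ⊆ G`: the least `n` such
that `g` is a product of `n` elements of `S ∪ S⁻¹` (with the empty product giving `1`). -/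
noncomputable def wordLength {G : Type*} [Group G] (S : Set G) (g : G) : ℕ :=
  sInf {n : ℕ | ∃ l : List G, l.length = n ∧ (∀ x ∈ l, x ∈ S ∨ x⁻¹ ∈ S) ∧ l.prod = g}

section WordLength

variable {G H : Type*} [Group G] [Group H] {S : Set G}

theorem wordLength_prod_le {l : List G} (hl : ∀ x ∈ l, x ∈ S ∨ x⁻¹ ∈ S) :
    wordLength S l.prod ≤ l.length :=
  Nat.sInf_le ⟨l, rfl, hl, rfl⟩

theorem exists_list_length_eq_wordLength (hgen : Subgroup.closure S = ⊤) (x : G) :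
    ∃ l : List G, l.length = wordLength S x ∧ (∀ y ∈ l, y ∈ S ∨ y⁻¹ ∈ S) ∧ l.prod = x := by
  have hx : x ∈ (Subgroup.closure S).toSubmonoid := by simp [hgen]
  rw [Subgroup.closure_toSubmonoid] at hx
  obtain ⟨l, hl, hprod⟩ := Submonoid.exists_list_of_mem_closure hx
  exact Nat.sInf_mem (s := {n : ℕ | ∃ l : List G, l.length = n ∧
    (∀ y ∈ l, y ∈ S ∨ y⁻¹ ∈ S) ∧ l.prod = x}) ⟨l.length, l, rfl, hl, hprod⟩

theorem wordLength_one : wordLength S (1 : G) = 0 :=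
  Nat.le_zero.mp (wordLength_prod_le (l := []) (by simp))

theorem wordLength_mul_le (hgen : Subgroup.closure S = ⊤) (x y : G) :
    wordLength S (x * y) ≤ wordLength S x + wordLength S y := by
  obtain ⟨l, hl, hlS, rfl⟩ := exists_list_length_eq_wordLength hgen x
  obtain ⟨m, hm, hmS, rfl⟩ := exists_list_length_eq_wordLength hgen y
  rw [← hl, ← hm, ← List.prod_append, ← List.length_append]
  refine wordLength_prod_le fun z hz => ?_
  exact (List.mem_append.mp hz).elim (hlS z) (hmS z)

theorem wordLength_inv_le (hgen : Subgroup.closure S = ⊤) (x : G) :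
    wordLength S x⁻¹ ≤ wordLength S x := by
  obtain ⟨l, hl, hlS, rfl⟩ := exists_list_length_eq_wordLength hgen x
  rw [← hl, List.prod_inv_reverse]
  refine (wordLength_prod_le fun z hz => ?_).trans_eq (by simp)
  obtain ⟨y, hy, rfl⟩ := List.mem_map.mp (List.mem_reverse.mp hz)
  simpa [or_comm] using hlS y hy

/-- A homomorphism sending every generator to an element of length at most `K` stretches word
lengths by a factor of at most `K`. -/
theorem wordLength_map_le {T : Set H} (hgen : Subgroup.closure S = ⊤)
    (hgenT : Subgroup.closure T = ⊤) (f : G →* H) {K : ℝ}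
    (hK : ∀ s ∈ S, (wordLength T (f s) : ℝ) ≤ K) (x : G) :
    (wordLength T (f x) : ℝ) ≤ wordLength S x * K := by
  obtain ⟨l, hl, hlS, rfl⟩ := exists_list_length_eq_wordLength hgen x
  rw [← hl]
  clear hl
  induction l with
  | nil => simp [wordLength_one]
  | cons y l ih =>
    have hy : (wordLength T (f y) : ℝ) ≤ K := by
      rcases hlS y (by simp) with h | h
      · exact hK y h
      · have hinv := wordLength_inv_le hgenT (f y⁻¹)
        rw [map_inv, inv_inv, ← map_inv] at hinv
        exact (Nat.cast_le.mpr hinv).trans (hK _ h)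
    have hl := ih fun z hz => hlS z (List.mem_cons_of_mem y hz)
    have hmul : (wordLength T (f y * f l.prod) : ℝ) ≤
        wordLength T (f y) + wordLength T (f l.prod) := by
      exact_mod_cast wordLength_mul_le hgenT (f y) (f l.prod)
    rw [List.prod_cons, map_mul, List.length_cons]
    push_cast
    linarith

/-- The iterates of `x ↦ g * φ x * g⁻¹` are conjugates of the iterates of `φ`, by elements
`g * φ g * ⋯ * φ^[n - 1] g` whose length is controlled by the lengths of the `φ^[i] g`. -/
theorem exists_iterate_eq_conj (hgen : Subgroup.closure S = ⊤) {φ ψ : G ≃* G} {g : G}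
    (hψ : ∀ x : G, ψ x = g * φ x * g⁻¹) {B : ℕ → ℝ} (hB : Monotone B)
    (hg : ∀ n, (wordLength S (φ^[n] g) : ℝ) ≤ B n) (n : ℕ) :
    ∃ h : G, (wordLength S h : ℝ) ≤ n * B n ∧ ∀ x, ψ^[n] x = h * φ^[n] x * h⁻¹ := by
  induction n with
  | zero => exact ⟨1, by simp [wordLength_one], by simp⟩
  | succ n ih =>
    obtain ⟨h, hh, hconj⟩ := ih
    refine ⟨h * φ^[n] g, ?_, fun x => ?_⟩
    · have hmul : (wordLength S (h * φ^[n] g) : ℝ) ≤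
          wordLength S h + wordLength S (φ^[n] g) := by
        exact_mod_cast wordLength_mul_le hgen h (φ^[n] g)
      calc (wordLength S (h * φ^[n] g) : ℝ) ≤ n * B n + B n := by linarith [hg n]
        _ = (n + 1 : ℕ) * B n := by push_cast; ring
        _ ≤ (n + 1 : ℕ) * B (n + 1) := by gcongr; exact hB n.le_succ
    · rw [Function.iterate_succ_apply, Function.iterate_succ_apply, hconj, hψ,
        iterate_map_mul, iterate_map_mul, iterate_map_inv]
      group

end WordLength

/-- If `φ` is an automorphism of a finitely generated group `G` with
`max_{s ∈ S} |φⁿ(s)|_S ≤ C·(n+1)ᵖ`, and `ψ(x) = g·φ(x)·g⁻¹`, then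
`max_{s ∈ S} |ψⁿ(s)|_S ≤ C'·(n+1)^(p+1)` for some constant `C' > 0`. -/
theorem polynomial_growth_of_conjugated_automorphism
    {G : Type*} [Group G] (S : Finset G) (hS : S.Nonempty)
    (hgen : Subgroup.closure (S : Set G) = ⊤)
    (φ ψ : G ≃* G) (g : G) (hψ : ∀ x : G, ψ x = g * φ x * g⁻¹)
    (C : ℝ) (hC : 0 < C) (p : ℕ)
    (hbound : ∀ n : ℕ,
      (S.sup' hS fun s => (wordLength (S : Set G) ((⇑φ)^[n] s) : ℝ)) ≤ C * ((n : ℝ) + 1) ^ p) :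
    ∃ C' : ℝ, 0 < C' ∧ ∀ n : ℕ,
      (S.sup' hS fun s => (wordLength (S : Set G) ((⇑ψ)^[n] s) : ℝ)) ≤
        C' * ((n : ℝ) + 1) ^ (p + 1) := by
  have hφ (n : ℕ) (s : G) (hs : s ∈ (S : Set G)) :
      (wordLength (S : Set G) (φ^[n] s) : ℝ) ≤ C * ((n : ℝ) + 1) ^ p :=
    (Finset.sup'_le_iff hS _).mp (hbound n) s hs
  set L : ℝ := (wordLength (S : Set G) g : ℝ)
  have hL : 0 ≤ L := Nat.cast_nonneg _
  have hg (n : ℕ) :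
      (wordLength (S : Set G) (φ^[n] g) : ℝ) ≤ L * (C * ((n : ℝ) + 1) ^ p) :=
    wordLength_map_le hgen hgen (MonoidHom.mk' φ^[n] (iterate_map_mul φ n)) (hφ n) g
  have hmono : Monotone fun n : ℕ => L * (C * ((n : ℝ) + 1) ^ p) := by
    intro m n hmn
    dsimp only
    gcongr
  refine ⟨(2 * L + 1) * C, by positivity, fun n => Finset.sup'_le hS _ fun s hs => ?_⟩
  obtain ⟨h, hh, hconj⟩ := exists_iterate_eq_conj hgen hψ hmono hg n
  rw [hconj]
  have hlen : (wordLength (S : Set G) (h * φ^[n] s * h⁻¹) : ℝ) ≤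
      wordLength (S : Set G) h + wordLength (S : Set G) (φ^[n] s) +
        wordLength (S : Set G) h := by
    exact_mod_cast (wordLength_mul_le hgen _ _).trans
      (add_le_add (wordLength_mul_le hgen _ _) (wordLength_inv_le hgen h))
  have hpow : 0 ≤ C * ((n : ℝ) + 1) ^ p := by positivity
  calc (wordLength (S : Set G) (h * φ^[n] s * h⁻¹) : ℝ)
      ≤ (2 * L * n + 1) * (C * ((n : ℝ) + 1) ^ p) := by linarith [hφ n s hs]
    _ ≤ ((2 * L + 1) * (n + 1)) * (C * ((n : ℝ) + 1) ^ p) := by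
        gcongr
        linarith [(Nat.cast_nonneg n : (0 : ℝ) ≤ n)]
    _ = (2 * L + 1) * C * ((n : ℝ) + 1) ^ (p + 1) := by ring
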